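/- arXiv:math/9804025 — 4 statements merged into one kernel-verified Lean document; each statement's English description precedes it below -/
import Mathlib

section
/- Let p_i denote the i-th prime number. Let r and s be positive integers and let q = p_{r+1} p_{r+2} \cdots p_{r+s}. If m is a positive integer that is not divisible by any of the primes p_1, \ldots, p_r, and m has at most s distinct prime factors, then \phi(m)/m \ge \phi(q)/q, where \phi is Euler's totient function. -/
/-- `nthPrime i` is the `i`-th prime number (1-indexed): `nthPrime 1 = 2`, etc. -/
noncomputable def nthPrime (i : ℕ) : ℕ := Nat.nth Nat.Prime (i - 1)

theorem nthPrime_prime (i : ℕ) : (nthPrime i).Prime := Nat.prime_nth_prime _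

theorem monotone_nthPrime : Monotone nthPrime := fun _ _ h =>
  Nat.nth_monotone Nat.infinite_setOfPred_prime (Nat.sub_le_sub_right h 1)

theorem nthPrime_injOn : Set.InjOn nthPrime {i | 1 ≤ i} := by
  intro i hi j hj h
  have h' := Nat.nth_injective Nat.infinite_setOfPred_prime h
  simp only [Set.mem_ofPred_eq] at hi hj
  omega

theorem nthPrime_count_add_one {p : ℕ} (hp : p.Prime) :
    nthPrime (Nat.count Nat.Prime p + 1) = p := by
  simp [nthPrime, Nat.nth_count hp]

theorem totient_div_self_eq_prod {n : ℕ} (hn : n ≠ 0) :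
    (n.totient : ℚ) / n = ∏ p ∈ n.primeFactors, (1 - (p : ℚ)⁻¹) := by
  rw [Nat.totient_eq_mul_prod_factors, mul_div_cancel_left₀ _ (by exact_mod_cast hn)]

/-- For a monotone weight with values in `[0, 1]`, the `s` integers following `r` have the least
product among the sets of at most `s` integers exceeding `r`. -/
theorem prod_Icc_le_prod_of_card_le {f : ℕ → ℚ} (hf : Monotone f) (h0 : ∀ i, 0 ≤ f i)
    (h1 : ∀ i, f i ≤ 1) (r s : ℕ) (T : Finset ℕ) (hT : ∀ i ∈ T, r + 1 ≤ i) (hs : T.card ≤ s) :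
    ∏ i ∈ Finset.Icc (r + 1) (r + s), f i ≤ ∏ i ∈ T, f i := by
  induction s generalizing T with
  | zero => simp [Finset.card_eq_zero.mp (Nat.le_zero.mp hs)]
  | succ s ih =>
    by_cases hM : ∃ M ∈ T, r + s + 1 ≤ M
    · obtain ⟨M, hMT, hM⟩ := hM
      rw [← Finset.prod_erase_mul T f hMT, ← add_assoc,
        Finset.prod_Icc_succ_top (by omega : r + 1 ≤ r + s + 1)]
      refine mul_le_mul (ih _ (fun i hi => hT i (Finset.mem_of_mem_erase hi)) ?_) (hf hM) (h0 _)
        (Finset.prod_nonneg fun i _ => h0 i)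
      rw [Finset.card_erase_of_mem hMT]
      omega
    · push Not at hM
      have hsub : T ⊆ Finset.Icc (r + 1) (r + (s + 1)) := fun i hi =>
        Finset.mem_Icc.mpr ⟨hT i hi, by have := hM i hi; omega⟩
      rw [← Finset.prod_sdiff hsub]
      exact mul_le_of_le_one_left (Finset.prod_nonneg fun i _ => h0 i)
        (Finset.prod_le_one (fun i _ => h0 i) fun i _ => h1 i)

theorem claim1b (r s : ℕ) (hr : 0 < r) (hs : 0 < s)
    (q : ℕ) (hq : q = ∏ i ∈ Finset.Icc (r + 1) (r + s), nthPrime i)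
    (m : ℕ) (hm : 0 < m)
    (hdvd : ∀ i, 1 ≤ i → i ≤ r → ¬ nthPrime i ∣ m)
    (hcard : m.primeFactors.card ≤ s) :
    (m.totient : ℚ) / m ≥ (q.totient : ℚ) / q := by
  have hinj : Set.InjOn nthPrime (Finset.Icc (r + 1) (r + s) : Finset ℕ) :=
    nthPrime_injOn.mono fun i hi => by
      have := (Finset.mem_Icc.mp (Finset.mem_coe.mp hi)).1
      simp only [Set.mem_ofPred_eq]
      omega
  have hq0 : q ≠ 0 := hq ▸ Finset.prod_ne_zero_iff.mpr fun i _ => (nthPrime_prime i).ne_zero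
  have hqf : q.primeFactors = (Finset.Icc (r + 1) (r + s)).image nthPrime := by
    rw [hq, ← Finset.prod_image (f := fun p => p) hinj]
    refine Nat.primeFactors_prod fun p hp => ?_
    obtain ⟨i, -, rfl⟩ := Finset.mem_image.mp hp
    exact nthPrime_prime i
  rw [ge_iff_le, totient_div_self_eq_prod hm.ne', totient_div_self_eq_prod hq0, hqf,
    Finset.prod_image hinj]
  have hindex : ∀ p ∈ m.primeFactors, nthPrime (Nat.count Nat.Prime p + 1) = p := fun p hp =>
    nthPrime_count_add_one (Nat.prime_of_mem_primeFactors hp)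
  have hprod : ∏ i ∈ m.primeFactors.image (fun p => Nat.count Nat.Prime p + 1),
      (1 - (nthPrime i : ℚ)⁻¹) = ∏ p ∈ m.primeFactors, (1 - (p : ℚ)⁻¹) := by
    rw [Finset.prod_image fun a ha b hb h => by
      rw [← hindex a ha, ← hindex b hb]; exact congrArg nthPrime h]
    exact Finset.prod_congr rfl fun p hp => by rw [hindex p hp]
  rw [← hprod]
  have hpos : ∀ i, (1 : ℚ) ≤ nthPrime i := fun i => by exact_mod_cast (nthPrime_prime i).one_le
  refine prod_Icc_le_prod_of_card_le (f := fun i => 1 - (nthPrime i : ℚ)⁻¹) ?_ ?_ ?_ r s _ ?_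
    (Finset.card_image_le.trans hcard)
  · intro i j hij
    exact sub_le_sub_left (inv_anti₀ (zero_lt_one.trans_le (hpos i))
      (by exact_mod_cast monotone_nthPrime hij)) 1
  · exact fun i => sub_nonneg.mpr (inv_le_one_of_one_le₀ (hpos i))
  · exact fun i => sub_le_self 1 (inv_nonneg.mpr (zero_le_one.trans (hpos i)))
  · intro i hi
    obtain ⟨p, hp, rfl⟩ := Finset.mem_image.mp hi
    by_contra! h
    exact hdvd _ (Nat.le_add_left 1 _) (Nat.lt_succ_iff.mp h)
      (by rw [hindex p hp]; exact Nat.dvd_of_mem_primeFactors hp)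
end

section
/- Every positive integer m satisfying m \equiv 1 \pmod{30} and \phi(m)/m < 4/15 has more than 381 distinct prime factors, where \phi is Euler's totient function. -/
/-- The integers in `[7, 2657]` that are either among the primes up to `47` or coprime to all of
them; these are exactly the primes in that interval. -/
def sievedInterval : Finset ℕ :=
  (Finset.Icc 7 2657).filter fun p =>
    p ∈ [7, 11, 13, 17, 19, 23, 29, 31, 37, 41, 43, 47] ∨ Nat.gcd p 614889782588491410 = 1

theorem card_sievedInterval : sievedInterval.card = 381 := by
  decide +kernel

theorem four_mul_prod_sievedInterval_lt :
    4 * ∏ p ∈ sievedInterval, p < 15 * ∏ p ∈ sievedInterval, (p - 1) := by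
  decide +kernel

theorem Nat.Prime.mem_sievedInterval {p : ℕ} (hp : p.Prime) (h7 : 7 ≤ p) (hle : p ≤ 2657) :
    p ∈ sievedInterval := by
  refine Finset.mem_filter.2 ⟨Finset.mem_Icc.2 ⟨h7, hle⟩, ?_⟩
  by_cases hd : p ∣ 614889782588491410
  · left
    have hfac : 614889782588491410 =
        [2, 3, 5, 7, 11, 13, 17, 19, 23, 29, 31, 37, 41, 43, 47].prod := by norm_num
    rw [hfac, hp.prime.dvd_prod_iff] at hd
    obtain ⟨q, hq, hpq⟩ := hd
    have hqp : q.Prime := by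
      simp only [List.mem_cons, List.not_mem_nil, or_false] at hq
      rcases hq with rfl | rfl | rfl | rfl | rfl | rfl | rfl | rfl | rfl | rfl | rfl | rfl | rfl |
        rfl | rfl <;> norm_num
    obtain rfl := (Nat.prime_dvd_prime_iff_eq hp hqp).1 hpq
    simp only [List.mem_cons, List.not_mem_nil, or_false] at hq ⊢
    omega
  · exact .inr ((Nat.Prime.coprime_iff_not_dvd hp).2 hd)

theorem lt_prod_sievedInterval :
    (4 / 15 : ℚ) < ∏ p ∈ sievedInterval, (1 - (p : ℚ)⁻¹) := by
  have hpos : ∀ p ∈ sievedInterval, 1 ≤ p := fun p hp => by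
    have := (Finset.mem_Icc.1 (Finset.mem_filter.1 hp).1).1
    omega
  have heq : ∏ p ∈ sievedInterval, (1 - (p : ℚ)⁻¹) =
      ((∏ p ∈ sievedInterval, (p - 1) : ℕ) : ℚ) / ((∏ p ∈ sievedInterval, p : ℕ) : ℚ) := by
    rw [Nat.cast_prod, Nat.cast_prod, ← Finset.prod_div_distrib]
    refine Finset.prod_congr rfl fun p hp => ?_
    have h1 := hpos p hp
    have h0 : (p : ℚ) ≠ 0 := by positivity
    rw [Nat.cast_sub h1]
    field_simp
    simp
  have hprod : (0 : ℚ) < ((∏ p ∈ sievedInterval, p : ℕ) : ℚ) :=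
    Nat.cast_pos.2 (Finset.prod_pos hpos)
  have hlt : (4 : ℚ) * ((∏ p ∈ sievedInterval, p : ℕ) : ℚ) <
      15 * ((∏ p ∈ sievedInterval, (p - 1) : ℕ) : ℚ) := by
    exact_mod_cast four_mul_prod_sievedInterval_lt
  rw [heq, div_lt_div_iff₀ (by norm_num) hprod]
  linarith

/-- If `S` is no larger than `T`, and `f` is at least `c ∈ [0, 1]` on `S \ T` and at most `c` on
`T \ S`, then the product of `f` over `S` is at least its product over `T`. -/
theorem Finset.prod_le_prod_of_card_le_of_threshold {α R : Type*} [DecidableEq α] [CommRing R]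
    [LinearOrder R] [IsStrictOrderedRing R] {S T : Finset α} {f : α → R} {c : R}
    (hcard : S.card ≤ T.card) (hc0 : 0 ≤ c) (hc1 : c ≤ 1) (hT0 : ∀ a ∈ T, 0 ≤ f a)
    (hS : ∀ a ∈ S \ T, c ≤ f a) (hT : ∀ a ∈ T \ S, f a ≤ c) :
    ∏ a ∈ T, f a ≤ ∏ a ∈ S, f a := by
  rw [← Finset.prod_inter_mul_prod_sdiff T S f, ← Finset.prod_inter_mul_prod_sdiff S T f,
    Finset.inter_comm S T]
  refine mul_le_mul_of_nonneg_left ?_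
    (Finset.prod_nonneg fun a ha => hT0 a (Finset.mem_inter.1 ha).1)
  calc ∏ a ∈ T \ S, f a ≤ c ^ (T \ S).card :=
        (Finset.prod_le_prod (fun a ha => hT0 a (Finset.mem_sdiff.1 ha).1) hT).trans_eq
          (Finset.prod_const c)
    _ ≤ c ^ (S \ T).card :=
        pow_le_pow_of_le_one hc0 hc1 (Finset.card_sdiff_le_card_sdiff_iff.2 hcard)
    _ ≤ ∏ a ∈ S \ T, f a :=
        (Finset.prod_const c).symm.trans_le (Finset.prod_le_prod (fun _ _ => hc0) hS)

theorem seven_le_of_prime_of_dvd {m p : ℕ} (hmod : m % 30 = 1) (hp : p.Prime) (hd : p ∣ m) :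
    7 ≤ p := by
  by_contra! h
  interval_cases p <;> first | omega | exact absurd hp (by norm_num)

theorem many_prime_factors (m : ℕ) (hm : 0 < m) (hmod : m % 30 = 1)
    (hratio : (m.totient : ℚ) / m < 4 / 15) :
    381 < m.primeFactors.card := by
  by_contra! hcard
  have hm0 : (m : ℚ) ≠ 0 := by positivity
  rw [Nat.totient_eq_mul_prod_factors, mul_div_cancel_left₀ _ hm0] at hratio
  refine (lt_prod_sievedInterval.trans_le ?_).not_gt hratio
  have hbounds : ∀ p ∈ sievedInterval, 7 ≤ p ∧ p ≤ 2657 := fun p hp =>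
    Finset.mem_Icc.1 (Finset.mem_filter.1 hp).1
  refine Finset.prod_le_prod_of_card_le_of_threshold (c := 1 - (2657 : ℚ)⁻¹)
    (hcard.trans_eq card_sievedInterval.symm) (by norm_num) (by norm_num) ?_ ?_ ?_
  · intro p hp
    have h1 : (1 : ℚ) ≤ p := by exact_mod_cast (by norm_num : 1 ≤ 7).trans (hbounds p hp).1
    exact sub_nonneg.2 (inv_le_one_of_one_le₀ h1)
  · intro p hp
    obtain ⟨hpm, hpT⟩ := Finset.mem_sdiff.1 hp
    have hprime := Nat.prime_of_mem_primeFactors hpm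
    have h7 := seven_le_of_prime_of_dvd hmod hprime (Nat.dvd_of_mem_primeFactors hpm)
    have hlt : (2657 : ℚ) ≤ p := by
      exact_mod_cast le_of_not_ge fun hle => hpT (hprime.mem_sievedInterval h7 hle)
    gcongr
  · intro p hp
    obtain ⟨h7, hle⟩ := hbounds p (Finset.mem_sdiff.1 hp).1
    have hpos : (0 : ℚ) < p := by exact_mod_cast (by norm_num : 0 < 7).trans_le h7
    have hle' : (p : ℚ) ≤ 2657 := by exact_mod_cast hle
    gcongr
end

section
/- Let p_i denote the i-th prime number and let q_1 = p_4 p_5 \cdots p_{384}. Then \phi(q_1)/q_1 > 4/15, where \phi is Euler's totient function. -/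
/-- A primality test by trial division by the primes below `53`, valid below `53 ^ 2`. -/
def smallPrimeTest (n : ℕ) : Bool :=
  n ∈ [2, 3, 5, 7, 11, 13, 17, 19, 23, 29, 31, 37, 41, 43, 47] ||
    (n != 1 && n.gcd 614889782588491410 == 1)

theorem prime_dvd_of_lt_53 {p : ℕ} (hp : p.Prime) (h : p < 53) : p ∣ 614889782588491410 := by
  interval_cases p <;> revert hp <;> norm_num

theorem prime_iff_smallPrimeTest {n : ℕ} (hn : n < 2809) :
    n.Prime ↔ smallPrimeTest n = true := by
  have hfac : 614889782588491410 =
      2 * 3 * 5 * 7 * 11 * 13 * 17 * 19 * 23 * 29 * 31 * 37 * 41 * 43 * 47 := by norm_num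
  simp only [smallPrimeTest, Bool.or_eq_true, decide_eq_true_eq, Bool.and_eq_true, bne_iff_ne,
    beq_iff_eq]
  constructor
  · intro hp
    by_cases h : n < 53
    · left
      interval_cases n <;> revert hp <;> norm_num
    · refine Or.inr ⟨hp.one_lt.ne', (Nat.Prime.coprime_iff_not_dvd hp).2 fun hd => ?_⟩
      rw [hfac] at hd
      simp only [hp.dvd_mul] at hd
      have key : ∀ m, 0 < m → m < 53 → ¬ n ∣ m := fun m h0 h1 hm =>
        absurd (Nat.le_of_dvd h0 hm) (by omega)
      simp [key] at hd
  · rintro (h | ⟨h1, h⟩)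
    · simp only [List.mem_cons, List.not_mem_nil, or_false] at h
      rcases h with rfl | rfl | rfl | rfl | rfl | rfl | rfl | rfl | rfl | rfl | rfl | rfl | rfl |
        rfl | rfl <;> norm_num
    · have h0 : 0 < n := Nat.pos_of_ne_zero (by rintro rfl; norm_num at h)
      by_contra hnp
      have hsq := Nat.minFac_sq_le_self h0 hnp
      have hlt : n.minFac < 53 := by nlinarith
      have hmp := Nat.minFac_prime h1
      have hd := Nat.dvd_gcd n.minFac_dvd (prime_dvd_of_lt_53 hmp hlt)
      rw [h] at hd
      exact hmp.one_lt.ne' (Nat.dvd_one.1 hd)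

theorem count_prime_2658 : Nat.count Nat.Prime 2658 = 384 := by
  have h : ((Finset.range 2658).filter fun n => smallPrimeTest n = true).card = 384 := by
    decide +kernel
  rw [Nat.count_eq_card_filter_range, ← h]
  refine congrArg Finset.card (Finset.filter_congr fun n hn => prime_iff_smallPrimeTest ?_)
  have := Finset.mem_range.1 hn
  omega

theorem injOn_nthPrime_Icc (a b : ℕ) (ha : 1 ≤ a) :
    Set.InjOn nthPrime (Finset.Icc a b : Finset ℕ) := by
  intro i hi j hj h
  have := Nat.nth_injective Nat.infinite_setOfPred_prime h
  simp only [Finset.coe_Icc, Set.mem_Icc] at hi hj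
  omega

theorem image_nthPrime_Icc :
    (Finset.Icc 4 384).image nthPrime =
      (Finset.range 2658).filter fun n => 5 < n ∧ smallPrimeTest n = true := by
  ext p
  simp only [Finset.mem_image, Finset.mem_Icc, Finset.mem_filter, Finset.mem_range]
  constructor
  · rintro ⟨i, ⟨h4, hi⟩, rfl⟩
    have hlt : nthPrime i < 2658 := Nat.nth_lt_of_lt_count (by rw [count_prime_2658]; omega)
    refine ⟨hlt, ?_, (prime_iff_smallPrimeTest (by omega)).1 (Nat.prime_nth_prime _)⟩
    rw [← Nat.nth_prime_two_eq_five]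
    exact Nat.nth_strictMono Nat.infinite_setOfPred_prime (by omega)
  · rintro ⟨hlt, h5, hp⟩
    replace hp := (prime_iff_smallPrimeTest (by omega)).2 hp
    have hn := Nat.nth_count hp
    have hu := Nat.count_strict_mono hp hlt
    rw [count_prime_2658] at hu
    have hl : 2 < Nat.count Nat.Prime p := by
      rw [← Nat.nth_lt_nth Nat.infinite_setOfPred_prime, hn, Nat.nth_prime_two_eq_five]
      exact h5
    exact ⟨Nat.count Nat.Prime p + 1, ⟨by omega, by omega⟩, hn⟩

theorem totient_div_prod_primes (s : Finset ℕ) (hs : ∀ p ∈ s, p.Prime) :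
    ((∏ p ∈ s, p).totient : ℚ) / (∏ p ∈ s, p : ℕ) =
      (∏ p ∈ s, (p - 1) : ℕ) / (∏ p ∈ s, p : ℕ) := by
  have hne : ∏ p ∈ s, p ≠ 0 := Finset.prod_ne_zero_iff.2 fun p hp => (hs p hp).ne_zero
  have h := Nat.totient_mul_prod_primeFactors (∏ p ∈ s, p)
  rw [Nat.primeFactors_prod hs, mul_comm] at h
  rw [mul_left_cancel₀ hne h]

theorem q1_ratio_gt (q₁ : ℕ) (hq₁ : q₁ = ∏ i ∈ Finset.Icc 4 384, nthPrime i) :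
    (q₁.totient : ℚ) / q₁ > 4 / 15 := by
  have hprod : q₁ = ∏ p ∈ (Finset.Icc 4 384).image nthPrime, p := by
    rw [hq₁, Finset.prod_image (injOn_nthPrime_Icc 4 384 (by norm_num))]
  have hprime : ∀ p ∈ (Finset.Icc 4 384).image nthPrime, p.Prime := by
    intro p hp
    obtain ⟨i, -, rfl⟩ := Finset.mem_image.1 hp
    exact Nat.prime_nth_prime _
  have hpos : 0 < ∏ p ∈ (Finset.Icc 4 384).image nthPrime, p :=
    Finset.prod_pos fun p hp => (hprime p hp).pos
  rw [hprod, totient_div_prod_primes _ hprime, gt_iff_lt,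
    div_lt_div_iff₀ (by norm_num) (by exact_mod_cast hpos), image_nthPrime_Icc]
  have key : 4 * ∏ p ∈ (Finset.range 2658).filter (fun n => 5 < n ∧ smallPrimeTest n = true), p <
      (∏ p ∈ (Finset.range 2658).filter (fun n => 5 < n ∧ smallPrimeTest n = true), (p - 1)) *
        15 := by
    decide +kernel
  exact_mod_cast key
end

section
/- Let p_i denote the i-th prime number and let z = (p_4 p_5 \cdots p_{383}) \cdot p_{385} \cdot p_{388}. If m is a positive integer with at least 382 distinct prime factors, none of which is 2, 3, or 5, and m < z, then m = (p_4 p_5 \cdots p_{382}) \cdot m' where m' is one of the eight products p_{383}p_{384}p_{385}, p_{383}p_{384}p_{386}, p_{383}p_{385}p_{386}, p_{383}p_{384}p_{387}, p_{383}p_{385}p_{387}, p_{384}p_{385}p_{386}, p_{383}p_{384}p_{388}, p_{383}p_{386}p_{387}; and none of these eight values of m is congruent to 1 modulo 30. -/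
/-- The primes below `52`. -/
def primesBelow52 : List ℕ := [2, 3, 5, 7, 11, 13, 17, 19, 23, 29, 31, 37, 41, 43, 47]

/-- A primality test valid below `52 ^ 2`: the numeral is the product of the primes below `52`. -/
def primeTest (n : ℕ) : Bool :=
  Nat.ble 2 n && ((Nat.gcd n 614889782588491410).beq 1 || Nat.ble n 51 && primesBelow52.contains n)

theorem primeTest_iff_prime {n : ℕ} (hn : n < 2704) : primeTest n = true ↔ n.Prime := by
  have hprod : 614889782588491410 = primesBelow52.prod := by decide +kernel
  have hprime : ∀ p ∈ primesBelow52, p.Prime := by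
    simp only [primesBelow52, List.forall_mem_cons]
    norm_num
  have hle : ∀ p ∈ primesBelow52, p ≤ 51 := by decide
  have hmem : ∀ p < 52, p.Prime → p ∈ primesBelow52 := by
    intro p hp hpp
    interval_cases p <;> first | decide | (norm_num at hpp)
  simp only [primeTest, hprod, Bool.and_eq_true, Nat.ble_eq, Bool.or_eq_true,
    Nat.beq_eq, List.contains_iff_mem]
  constructor
  · rintro ⟨h2, h | ⟨-, h⟩⟩
    · by_contra hnp
      have hmin : n.minFac.Prime := Nat.minFac_prime (by omega)
      have hsq := Nat.minFac_sq_le_self (by omega) hnp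
      have hdvd : n.minFac ∣ Nat.gcd n primesBelow52.prod :=
        Nat.dvd_gcd n.minFac_dvd (List.dvd_prod (hmem _ (by nlinarith) hmin))
      rw [h] at hdvd
      exact hmin.one_lt.ne' (Nat.dvd_one.mp hdvd)
    · exact hprime n h
  · intro hp
    refine ⟨hp.two_le, ?_⟩
    rcases Nat.coprime_or_dvd_of_prime hp primesBelow52.prod with h | h
    · exact Or.inl h
    · obtain ⟨p, hpmem, hnp⟩ := (Prime.dvd_prod_iff hp.prime).mp h
      rw [(Nat.prime_dvd_prime_iff_eq hp (hprime p hpmem)).mp hnp]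
      exact Or.inr ⟨hle p hpmem, hpmem⟩

theorem count_prime_nthPrime (i : ℕ) : Nat.count Nat.Prime (nthPrime i) = i - 1 :=
  Nat.count_nth_of_infinite Nat.infinite_setOfPred_prime _

theorem count_prime_add_eq_card {p d : ℕ} (h : p + d ≤ 2704) :
    Nat.count (fun k => (p + k).Prime) d =
      ((Finset.range d).filter fun k => primeTest (p + k) = true).card := by
  rw [Nat.count_eq_card_filter_range]
  congr 1
  refine Finset.filter_congr fun k hk => ?_
  have := Finset.mem_range.mp hk
  exact (primeTest_iff_prime (by omega)).symm

theorem nthPrime_add_eq (i j p d : ℕ) (hi : 1 ≤ i) (h : nthPrime i = p) (hlt : p + d < 2704)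
    (hprime : primeTest (p + d) = true)
    (hcard : ((Finset.range d).filter fun k => primeTest (p + k) = true).card = j) :
    nthPrime (i + j) = p + d := by
  rw [← nthPrime_count_add_one ((primeTest_iff_prime hlt).mp hprime), Nat.count_add,
    count_prime_add_eq_card hlt.le, hcard, ← h, count_prime_nthPrime]
  congr 1
  omega

theorem nthPrime_strictMonoOn : StrictMonoOn nthPrime (Set.Ici 1) := by
  intro i hi j hj hij
  simp only [Set.mem_Ici] at hi hj
  exact Nat.nth_strictMono Nat.infinite_setOfPred_prime (by omega)

theorem nthPrime_four : nthPrime 4 = 7 :=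
  nthPrime_add_eq 1 3 2 5 le_rfl Nat.nth_prime_zero_eq_two (by norm_num)
    (by decide +kernel) (by decide +kernel)

theorem nthPrime_382 : nthPrime 382 = 2633 :=
  nthPrime_add_eq 4 378 7 2626 (by norm_num) nthPrime_four (by norm_num)
    (by decide +kernel) (by decide +kernel)

theorem nthPrime_383 : nthPrime 383 = 2647 :=
  nthPrime_add_eq 382 1 2633 14 (by norm_num) nthPrime_382 (by norm_num)
    (by decide +kernel) (by decide +kernel)

theorem nthPrime_384 : nthPrime 384 = 2657 :=
  nthPrime_add_eq 383 1 2647 10 (by norm_num) nthPrime_383 (by norm_num)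
    (by decide +kernel) (by decide +kernel)

theorem nthPrime_385 : nthPrime 385 = 2659 :=
  nthPrime_add_eq 384 1 2657 2 (by norm_num) nthPrime_384 (by norm_num)
    (by decide +kernel) (by decide +kernel)

theorem nthPrime_386 : nthPrime 386 = 2663 :=
  nthPrime_add_eq 385 1 2659 4 (by norm_num) nthPrime_385 (by norm_num)
    (by decide +kernel) (by decide +kernel)

theorem nthPrime_387 : nthPrime 387 = 2671 :=
  nthPrime_add_eq 386 1 2663 8 (by norm_num) nthPrime_386 (by norm_num)
    (by decide +kernel) (by decide +kernel)

theorem nthPrime_388 : nthPrime 388 = 2677 :=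
  nthPrime_add_eq 387 1 2671 6 (by norm_num) nthPrime_387 (by norm_num)
    (by decide +kernel) (by decide +kernel)

theorem image_nthPrime_Icc_s14 {a b : ℕ} (ha : 1 ≤ a) (hb : 1 ≤ b) :
    (Finset.Icc a b).image nthPrime =
      (Finset.Icc (nthPrime a) (nthPrime b)).filter Nat.Prime := by
  have hle {i j : ℕ} (hi : 1 ≤ i) (hj : 1 ≤ j) : nthPrime i ≤ nthPrime j ↔ i ≤ j :=
    nthPrime_strictMonoOn.le_iff_le hi hj
  ext x
  simp only [Finset.mem_image, Finset.mem_Icc, Finset.mem_filter]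
  constructor
  · rintro ⟨i, ⟨h1, h2⟩, rfl⟩
    have hi : 1 ≤ i := ha.trans h1
    exact ⟨⟨(hle ha hi).mpr h1, (hle hi hb).mpr h2⟩, nthPrime_prime i⟩
  · rintro ⟨⟨h1, h2⟩, hx⟩
    have hi : 1 ≤ Nat.count Nat.Prime x + 1 := by simp
    rw [← nthPrime_count_add_one hx] at h1 h2
    exact ⟨_, ⟨(hle ha hi).mp h1, (hle hi hb).mp h2⟩, nthPrime_count_add_one hx⟩

/-- The primes from `p_4 = 7` to `p_382 = 2633`. -/
def middlePrimes : Finset ℕ := (Finset.Icc 7 2633).filter (primeTest · = true)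

/-- The `382` smallest primes greater than `5`, that is, those from `7` to `2659`. -/
def smallestPrimes : Finset ℕ := (Finset.Icc 7 2659).filter (primeTest · = true)

theorem mem_middlePrimes {x : ℕ} : x ∈ middlePrimes ↔ (7 ≤ x ∧ x ≤ 2633) ∧ x.Prime := by
  rw [middlePrimes, Finset.mem_filter, Finset.mem_Icc]
  exact and_congr_right fun h => primeTest_iff_prime (by omega)

theorem mem_smallestPrimes {x : ℕ} : x ∈ smallestPrimes ↔ (7 ≤ x ∧ x ≤ 2659) ∧ x.Prime := by
  rw [smallestPrimes, Finset.mem_filter, Finset.mem_Icc]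
  exact and_congr_right fun h => primeTest_iff_prime (by omega)

theorem prod_middlePrimes_mod : (∏ x ∈ middlePrimes, x) % 30 = 1 := by
  decide +kernel

theorem image_nthPrime_eq_middlePrimes : (Finset.Icc 4 382).image nthPrime = middlePrimes := by
  ext x
  rw [image_nthPrime_Icc_s14 (by norm_num) (by norm_num), nthPrime_four, nthPrime_382,
    mem_middlePrimes, Finset.mem_filter, Finset.mem_Icc]

theorem injOn_nthPrime_Icc_s14 : Set.InjOn nthPrime (Finset.Icc 4 382) :=
  nthPrime_strictMonoOn.injOn.mono fun i hi => by
    simp only [Finset.coe_Icc, Set.mem_Icc] at hi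
    exact le_trans (by norm_num) hi.1

theorem card_middlePrimes : middlePrimes.card = 379 := by
  rw [← image_nthPrime_eq_middlePrimes, Finset.card_image_of_injOn injOn_nthPrime_Icc_s14,
    Nat.card_Icc]

theorem smallestPrimes_eq_union : smallestPrimes = middlePrimes ∪ {2647, 2657, 2659} := by
  have hIcc : Finset.Icc 7 2659 = Finset.Icc 7 2633 ∪ Finset.Ioc 2633 2659 := by
    ext x
    simp only [Finset.mem_union, Finset.mem_Icc, Finset.mem_Ioc]
    omega
  rw [smallestPrimes, hIcc, Finset.filter_union]
  congr 1

theorem disjoint_middlePrimes : Disjoint middlePrimes {2647, 2657, 2659} := by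
  simp [mem_middlePrimes]

theorem card_smallestPrimes : smallestPrimes.card = 382 := by
  rw [smallestPrimes_eq_union, Finset.card_union_of_disjoint disjoint_middlePrimes,
    card_middlePrimes]
  rfl

theorem prod_smallestPrimes :
    ∏ x ∈ smallestPrimes, x = (∏ x ∈ middlePrimes, x) * (2647 * 2657 * 2659) := by
  rw [smallestPrimes_eq_union, Finset.prod_union disjoint_middlePrimes]
  congr 1

theorem prod_nthPrime_Icc_four_382 :
    ∏ i ∈ Finset.Icc 4 382, nthPrime i = ∏ x ∈ middlePrimes, x := by
  rw [← image_nthPrime_eq_middlePrimes, Finset.prod_image injOn_nthPrime_Icc_s14]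

theorem prime_mem_of_lt_of_le {x : ℕ} (hx : x.Prime) (h1 : 2659 < x) (h2 : x ≤ 2679) :
    x = 2663 ∨ x = 2671 ∨ x = 2677 := by
  rw [← primeTest_iff_prime (by omega)] at hx
  revert hx
  interval_cases x <;> decide +kernel

theorem mem_smallestPrimes_cases {x : ℕ} (hx : x ∈ smallestPrimes) (h : x ∉ middlePrimes) :
    x = 2647 ∨ x = 2657 ∨ x = 2659 := by
  simpa [smallestPrimes_eq_union, h] using hx

section Exchange

variable {T : Finset ℕ}

theorem prod_smallestPrimes_le (hT : ∀ x ∈ T, x.Prime ∧ 7 ≤ x) (hcard : T.card = 382) :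
    ∏ x ∈ smallestPrimes, x ≤ ∏ x ∈ T, x := by
  have hsdiff : (smallestPrimes \ T).card = (T \ smallestPrimes).card :=
    Finset.card_sdiff_comm (card_smallestPrimes.trans hcard.symm)
  have hle : ∏ x ∈ smallestPrimes \ T, x ≤ 2659 ^ (smallestPrimes \ T).card := by
    refine Finset.prod_le_pow_card _ _ _ fun x hx => ?_
    exact (mem_smallestPrimes.mp (Finset.mem_sdiff.mp hx).1).1.2
  have hge : 2659 ^ (T \ smallestPrimes).card ≤ ∏ x ∈ T \ smallestPrimes, x := by
    refine Finset.pow_card_le_prod _ _ _ fun x hx => ?_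
    obtain ⟨hxT, hx⟩ := Finset.mem_sdiff.mp hx
    rw [mem_smallestPrimes] at hx
    have := hT x hxT
    by_contra!
    exact hx ⟨⟨by omega, by omega⟩, by tauto⟩
  rw [← Finset.prod_inter_mul_prod_sdiff smallestPrimes T,
    ← Finset.prod_inter_mul_prod_sdiff T smallestPrimes, Finset.inter_comm T]
  exact Nat.mul_le_mul_left _ (hle.trans (hsdiff ▸ hge))

theorem mul_prod_smallestPrimes_le (hT : ∀ x ∈ T, x.Prime ∧ 7 ≤ x) (hcard : T.card = 382)
    {a b : ℕ} (ha : a ∈ T) (hb : b ∈ smallestPrimes) (hbT : b ∉ T) :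
    a * ∏ x ∈ smallestPrimes, x ≤ b * ∏ x ∈ T, x := by
  have hnot : b ∉ T.erase a := fun h => hbT (Finset.mem_of_mem_erase h)
  have hmin : ∏ x ∈ smallestPrimes, x ≤ ∏ x ∈ insert b (T.erase a), x := by
    refine prod_smallestPrimes_le (fun x hx => ?_) ?_
    · rcases Finset.mem_insert.mp hx with rfl | hx
      · have := mem_smallestPrimes.mp hb
        exact ⟨this.2, this.1.1⟩
      · exact hT x (Finset.mem_of_mem_erase hx)
    · rw [Finset.card_insert_of_notMem hnot, Finset.card_erase_of_mem ha, hcard]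
  rw [Finset.prod_insert hnot] at hmin
  rw [← Finset.mul_prod_erase T (fun x => x) ha]
  calc a * ∏ x ∈ smallestPrimes, x ≤ a * (b * ∏ x ∈ T.erase a, x) := by gcongr
    _ = b * (a * ∏ x ∈ T.erase a, x) := by ring

theorem exchange_lt (hT : ∀ x ∈ T, x.Prime ∧ 7 ≤ x) (hcard : T.card = 382)
    (hlt : ∏ x ∈ T, x < (∏ x ∈ middlePrimes, x) * (2647 * 2659 * 2677))
    {a b : ℕ} (ha : a ∈ T) (hb : b ∈ smallestPrimes) (hbT : b ∉ T) :
    a * 2657 < b * 2677 := by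
  have h1 := mul_prod_smallestPrimes_le hT hcard ha hb hbT
  have hb0 : 0 < b := (mem_smallestPrimes.mp hb).2.pos
  rw [prod_smallestPrimes] at h1
  have h2 := h1.trans_lt (Nat.mul_lt_mul_of_pos_left hlt hb0)
  refine lt_of_mul_lt_mul_left (a := (∏ x ∈ middlePrimes, x) * (2647 * 2659)) ?_ (Nat.zero_le _)
  calc _ = a * ((∏ x ∈ middlePrimes, x) * (2647 * 2657 * 2659)) := by ring
    _ < b * ((∏ x ∈ middlePrimes, x) * (2647 * 2659 * 2677)) := h2
    _ = _ := by ring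

theorem exists_mem_sdiff_smallestPrimes (hcard : T.card = 382) {b : ℕ} (hb : b ∈ smallestPrimes)
    (hbT : b ∉ T) : ∃ a ∈ T, a ∉ smallestPrimes := by
  by_contra! h
  exact hbT (Finset.eq_of_subset_of_card_le h (card_smallestPrimes.trans hcard.symm).le ▸ hb)

theorem exists_mem_smallestPrimes_sdiff (hcard : T.card = 382) {a : ℕ} (ha : a ∈ T)
    (haS : a ∉ smallestPrimes) : ∃ b ∈ smallestPrimes, b ∉ T := by
  by_contra! h
  exact haS (Finset.eq_of_subset_of_card_le h (hcard.trans card_smallestPrimes.symm).le ▸ ha)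

theorem middlePrimes_subset (hT : ∀ x ∈ T, x.Prime ∧ 7 ≤ x) (hcard : T.card = 382)
    (hlt : ∏ x ∈ T, x < (∏ x ∈ middlePrimes, x) * (2647 * 2659 * 2677)) :
    middlePrimes ⊆ T := by
  intro b hb
  by_contra hbT
  have hbS : b ∈ smallestPrimes := smallestPrimes_eq_union ▸ Finset.mem_union_left _ hb
  obtain ⟨a, ha, haS⟩ := exists_mem_sdiff_smallestPrimes hcard hbS hbT
  have hab := exchange_lt hT hcard hlt ha hbS hbT
  have hb' := (mem_middlePrimes.mp hb).1.2
  have haT := hT a ha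
  exact haS (mem_smallestPrimes.mpr ⟨⟨haT.2, by omega⟩, haT.1⟩)

theorem sdiff_middlePrimes_subset (hT : ∀ x ∈ T, x.Prime ∧ 7 ≤ x) (hcard : T.card = 382)
    (hlt : ∏ x ∈ T, x < (∏ x ∈ middlePrimes, x) * (2647 * 2659 * 2677)) :
    T \ middlePrimes ⊆ {2647, 2657, 2659, 2663, 2671, 2677} := by
  intro a ha
  obtain ⟨haT, haM⟩ := Finset.mem_sdiff.mp ha
  simp only [Finset.mem_insert, Finset.mem_singleton]
  by_cases haS : a ∈ smallestPrimes
  · have := mem_smallestPrimes_cases haS haM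
    omega
  · obtain ⟨b, hb, hbT⟩ := exists_mem_smallestPrimes_sdiff hcard haT haS
    have hab := exchange_lt hT hcard hlt haT hb hbT
    have hb' := (mem_smallestPrimes.mp hb).1.2
    have hprime := hT a haT
    have h1 : 2659 < a := by
      by_contra! h
      exact haS (mem_smallestPrimes.mpr ⟨⟨hprime.2, h⟩, hprime.1⟩)
    have := prime_mem_of_lt_of_le hprime.1 h1 (by omega)
    omega

theorem prod_cases_of_powersetCard :
    ∀ U ∈ Finset.powersetCard 3 ({2647, 2657, 2659, 2663, 2671, 2677} : Finset ℕ),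
      ∏ x ∈ U, x < 2647 * 2659 * 2677 →
      ∏ x ∈ U, x ∈ ({2647 * 2657 * 2659, 2647 * 2657 * 2663, 2647 * 2659 * 2663,
        2647 * 2657 * 2671, 2647 * 2659 * 2671, 2657 * 2659 * 2663, 2647 * 2657 * 2677,
        2647 * 2663 * 2671} : Finset ℕ) := by
  decide +kernel

end Exchange

theorem eq_one_of_mul_lt {M n k : ℕ} (hn : M * (2647 * 2657 * 2659) ≤ n) (hk : 0 < k)
    (h : n * k < M * (2647 * 2659 * 2677)) : k = 1 := by
  by_contra hne
  have := Nat.mul_le_mul hn (show 2 ≤ k by omega)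
  omega

theorem numbers_below_z_with_many_prime_factors
    (z : ℕ) (hz : z = (∏ i ∈ Finset.Icc 4 383, nthPrime i) * nthPrime 385 * nthPrime 388)
    (S : Finset ℕ)
    (hS : S = { nthPrime 383 * nthPrime 384 * nthPrime 385,
                nthPrime 383 * nthPrime 384 * nthPrime 386,
                nthPrime 383 * nthPrime 385 * nthPrime 386,
                nthPrime 383 * nthPrime 384 * nthPrime 387,
                nthPrime 383 * nthPrime 385 * nthPrime 387,
                nthPrime 384 * nthPrime 385 * nthPrime 386,
                nthPrime 383 * nthPrime 384 * nthPrime 388,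
                nthPrime 383 * nthPrime 386 * nthPrime 387 }) :
    (∀ m : ℕ, 0 < m → 382 ≤ m.primeFactors.card →
        ¬ 2 ∣ m → ¬ 3 ∣ m → ¬ 5 ∣ m → m < z →
        ∃ m' ∈ S, m = (∏ i ∈ Finset.Icc 4 382, nthPrime i) * m') ∧
      ∀ m' ∈ S, ¬ ((∏ i ∈ Finset.Icc 4 382, nthPrime i) * m') % 30 = 1 := by
  have hz' : z = (∏ x ∈ middlePrimes, x) * (2647 * 2659 * 2677) := by
    rw [hz, Finset.prod_Icc_succ_top (by norm_num), prod_nthPrime_Icc_four_382, nthPrime_383,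
      nthPrime_385, nthPrime_388]
    ring
  rw [nthPrime_383, nthPrime_384, nthPrime_385, nthPrime_386, nthPrime_387, nthPrime_388] at hS
  rw [prod_nthPrime_Icc_four_382, hS]
  refine ⟨fun m hm hcard h2 h3 h5 hmz => ?_, fun m' hm' => ?_⟩
  · obtain ⟨T, hTm, hT382⟩ := Finset.exists_subset_card_eq hcard
    have hT : ∀ x ∈ T, x.Prime ∧ 7 ≤ x := by
      intro x hx
      have hxp := Nat.prime_of_mem_primeFactors (hTm hx)
      have hxd := Nat.dvd_of_mem_primeFactors (hTm hx)
      refine ⟨hxp, ?_⟩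
      by_contra! h
      interval_cases x <;> contradiction
    obtain ⟨k, rfl⟩ : ∏ x ∈ T, x ∣ m :=
      (Finset.prod_dvd_prod_of_subset _ _ _ hTm).trans (Nat.prod_primeFactors_dvd m)
    rw [hz'] at hmz
    have hmin := prod_smallestPrimes_le hT hT382
    rw [prod_smallestPrimes] at hmin
    obtain rfl : k = 1 := eq_one_of_mul_lt hmin (pos_of_mul_pos_right hm (Nat.zero_le _)) hmz
    rw [mul_one] at hmz
    have hsub := middlePrimes_subset hT hT382 hmz
    have hsplit : ∏ x ∈ T, x = (∏ x ∈ middlePrimes, x) * ∏ x ∈ T \ middlePrimes, x := by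
      rw [mul_comm, Finset.prod_sdiff hsub]
    refine ⟨∏ x ∈ T \ middlePrimes, x, prod_cases_of_powersetCard _ ?_ ?_, by
      rw [mul_one, hsplit]⟩
    · rw [Finset.mem_powersetCard, Finset.card_sdiff_of_subset hsub, hT382, card_middlePrimes]
      exact ⟨sdiff_middlePrimes_subset hT hT382 hmz, by norm_num⟩
    · rw [hsplit] at hmz
      exact lt_of_mul_lt_mul_left hmz (Nat.zero_le _)
  · rw [Nat.mul_mod, prod_middlePrimes_mod]
    revert m'
    decide +kernel
end
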